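/- Let r ≥ 2 be a fixed integer and k ≥ 1 a real parameter. For every complex s with Re(s) > 1, the Dirichlet series of F_{r,k}(n) = d(𝓜_r(n))/k^{ω(n)} converges absolutely and admits the Euler product ∑_{n=1}^{∞} F_{r,k}(n)/n^s = ∏_p ( 1 + (1/k)·∑_{a=1}^{∞} (⌈a/r⌉ + 1)·p^{−as} ), the product being over all primes p. -/

import Mathlib

/-- The generalized minimal power function `𝓜_r(n) = min {m ∈ ℕ : n ∣ m^r}`
(where `m` ranges over positive integers). -/
noncomputable def genMinPow (r n : ℕ) : ℕ := sInf {m : ℕ | 0 < m ∧ n ∣ m ^ r}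

/-- The weighted composite function `F_{r,k}(n) = d(𝓜_r(n)) / k^{ω(n)}`. -/
noncomputable def Frk (r : ℕ) (k : ℝ) (n : ℕ) : ℝ :=
  ((genMinPow r n).divisors.card : ℝ) / k ^ n.primeFactors.card

open ArithmeticFunction in
open scoped ArithmeticFunction.zeta ArithmeticFunction.sigma in
/-- The Dirichlet series of the divisor-counting function converges for `1 < re s`. -/
theorem LSeriesSummable_card_divisors {s : ℂ} (hs : 1 < s.re) :
    LSeriesSummable (fun n : ℕ ↦ (n.divisors.card : ℂ)) s := by
  have hζ := LSeriesSummable_zeta_iff.mpr hs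
  refine (LSeriesSummable_congr s fun {n} hn ↦ ?_).mp (hζ.convolution hζ)
  simp only [LSeries.convolution_def, ← Nat.map_div_right_divisors, Finset.sum_map]
  rw [Finset.card_eq_sum_ones, Nat.cast_sum]
  refine Finset.sum_congr rfl fun d hd ↦ ?_
  have hd0 : d ≠ 0 := (Nat.pos_of_mem_divisors hd).ne'
  have hnd : n / d ≠ 0 := (Nat.div_pos (Nat.divisor_le hd) (Nat.pos_of_ne_zero hd0)).ne'
  change ((ζ d : ℕ) : ℂ) * ((ζ (n / d) : ℕ) : ℂ) = _
  simp [hd0, hnd]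

namespace Nat

theorem ceilRoot_dvd_self {r : ℕ} (hr : r ≠ 0) (n : ℕ) : ceilRoot r n ∣ n :=
  (dvd_pow_iff_ceilRoot_dvd hr).1 (dvd_pow_self n hr)

theorem Coprime.ceilRoot {r m n : ℕ} (hr : r ≠ 0) (h : Coprime m n) :
    Coprime (ceilRoot r m) (ceilRoot r n) :=
  (h.coprime_dvd_left (ceilRoot_dvd_self hr m)).coprime_dvd_right (ceilRoot_dvd_self hr n)

theorem Coprime.ceilRoot_mul {r m n : ℕ} (hr : r ≠ 0) (h : Coprime m n) :
    Nat.ceilRoot r (m * n) = Nat.ceilRoot r m * Nat.ceilRoot r n := by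
  refine dvd_antisymm ?_ ?_
  · rw [← dvd_pow_iff_ceilRoot_dvd hr, mul_pow]
    exact mul_dvd_mul (dvd_ceilRoot_pow hr) (dvd_ceilRoot_pow hr)
  · refine (h.ceilRoot hr).mul_dvd_of_dvd_of_dvd ?_ ?_
    · exact (dvd_pow_iff_ceilRoot_dvd hr).1 ((Nat.dvd_mul_right m n).trans (dvd_ceilRoot_pow hr))
    · exact (dvd_pow_iff_ceilRoot_dvd hr).1 ((Nat.dvd_mul_left n m).trans (dvd_ceilRoot_pow hr))

theorem Prime.ceilRoot_pow {p : ℕ} (hp : p.Prime) {r : ℕ} (hr : r ≠ 0) (a : ℕ) :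
    ceilRoot r (p ^ a) = p ^ (a ⌈/⌉ r) := by
  refine eq_of_factorization_eq (ceilRoot_ne_zero.2 ⟨hr, pow_ne_zero _ hp.ne_zero⟩)
    (pow_ne_zero _ hp.ne_zero) fun q ↦ ?_
  rw [factorization_ceilRoot, hp.factorization_pow, hp.factorization_pow, Finsupp.ceilDiv_apply]
  by_cases h : p = q <;> simp [h]

theorem cast_ceilDiv_eq_ceil (a r : ℕ) (hr : r ≠ 0) :
    ((a ⌈/⌉ r : ℕ) : ℤ) = ⌈(a : ℚ) / (r : ℚ)⌉ := by
  have hr0 : (0 : ℚ) < r := by positivity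
  refine eq_of_forall_ge_iff fun c ↦ ?_
  rw [Int.ceil_le, div_le_iff₀ hr0]
  rcases lt_or_ge c 0 with hc | hc
  · have : (c : ℚ) * r < 0 := mul_neg_of_neg_of_pos (by exact_mod_cast hc) hr0
    have ha : (0 : ℚ) ≤ a := by positivity
    constructor <;> intro h
    · omega
    · linarith
  · lift c to ℕ using hc
    rw [Nat.cast_le, ceilDiv_le_iff_le_mul (pos_of_ne_zero hr), mul_comm]
    exact_mod_cast Iff.rfl

end Nat

theorem genMinPow_eq_ceilRoot {r : ℕ} (hr : r ≠ 0) (n : ℕ) :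
    genMinPow r n = Nat.ceilRoot r n := by
  rcases eq_or_ne n 0 with rfl | hn
  · have : {m : ℕ | 0 < m ∧ 0 ∣ m ^ r} = ∅ := by
      ext m
      simp +contextual [hr, Nat.pos_iff_ne_zero]
    rw [genMinPow, this, Nat.sInf_empty, Nat.ceilRoot_zero_right]
  · refine IsLeast.csInf_eq ⟨⟨Nat.pos_of_ne_zero (Nat.ceilRoot_ne_zero.2 ⟨hr, hn⟩),
      Nat.dvd_ceilRoot_pow hr⟩, ?_⟩
    rintro m ⟨hm, hmn⟩
    exact Nat.le_of_dvd hm ((Nat.dvd_pow_iff_ceilRoot_dvd hr).1 hmn)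

theorem Frk_one {r : ℕ} (hr : r ≠ 0) (k : ℝ) : Frk r k 1 = 1 := by
  simp [Frk, genMinPow_eq_ceilRoot hr, Nat.ceilRoot_one_right hr]

theorem Frk_mul {r m n : ℕ} (hr : r ≠ 0) (k : ℝ) (h : m.Coprime n) :
    Frk r k (m * n) = Frk r k m * Frk r k n := by
  simp only [Frk, genMinPow_eq_ceilRoot hr]
  rw [h.ceilRoot_mul hr, (h.ceilRoot hr).card_divisors_mul, h.primeFactors_mul,
    Finset.card_union_of_disjoint h.disjoint_primeFactors, pow_add, Nat.cast_mul, mul_div_mul_comm]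

theorem Frk_prime_pow_succ {r p : ℕ} (hr : r ≠ 0) (k : ℝ) (hp : p.Prime) (a : ℕ) :
    Frk r k (p ^ (a + 1)) = (⌈((a + 1 : ℕ) : ℚ) / (r : ℚ)⌉ + 1 : ℤ) / k := by
  rw [Frk, genMinPow_eq_ceilRoot hr, hp.ceilRoot_pow hr, Nat.divisors_prime_pow hp,
    Finset.card_map, Finset.card_range, Nat.primeFactors_prime_pow a.succ_ne_zero hp,
    Finset.card_singleton, pow_one, ← Nat.cast_ceilDiv_eq_ceil _ _ hr]
  norm_cast

theorem norm_Frk_le_card_divisors {r n : ℕ} {k : ℝ} (hr : r ≠ 0) (hk : 1 ≤ k) (hn : n ≠ 0) :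
    ‖(Frk r k n : ℂ)‖ ≤ ‖(n.divisors.card : ℂ)‖ := by
  have h0 : 0 ≤ Frk r k n := by unfold Frk; positivity
  rw [Complex.norm_real, Real.norm_of_nonneg h0, Complex.norm_natCast, Frk,
    genMinPow_eq_ceilRoot hr]
  refine (div_le_self (by positivity) (one_le_pow₀ hk)).trans ?_
  exact_mod_cast Finset.card_le_card (Nat.divisors_subset_of_dvd hn (Nat.ceilRoot_dvd_self hr n))

theorem LSeriesSummable_Frk {r : ℕ} {k : ℝ} (hr : r ≠ 0) (hk : 1 ≤ k) {s : ℂ} (hs : 1 < s.re) :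
    LSeriesSummable (fun n ↦ (Frk r k n : ℂ)) s := by
  refine Summable.of_norm_bounded (LSeriesSummable_card_divisors hs).norm fun n ↦ ?_
  rcases eq_or_ne n 0 with rfl | hn
  · simp
  · rw [LSeries.term_of_ne_zero hn, LSeries.term_of_ne_zero hn, norm_div, norm_div]
    exact div_le_div_of_nonneg_right (norm_Frk_le_card_divisors hr hk hn) (norm_nonneg _)

theorem LSeries_term_Frk_mul {r m n : ℕ} (hr : r ≠ 0) (k : ℝ) (s : ℂ) (h : m.Coprime n) :
    LSeries.term (fun n ↦ (Frk r k n : ℂ)) s (m * n) =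
      LSeries.term (fun n ↦ (Frk r k n : ℂ)) s m * LSeries.term (fun n ↦ (Frk r k n : ℂ)) s n := by
  rcases eq_or_ne m 0 with rfl | hm
  · simp
  rcases eq_or_ne n 0 with rfl | hn
  · simp
  rw [LSeries.term_of_ne_zero hm, LSeries.term_of_ne_zero hn,
    LSeries.term_of_ne_zero (mul_ne_zero hm hn), Frk_mul hr k h, Nat.cast_mul,
    Complex.natCast_mul_natCast_cpow, Complex.ofReal_mul, mul_div_mul_comm]

theorem LSeries_term_Frk_prime_pow_succ {r p : ℕ} (hr : r ≠ 0) (k : ℝ) (s : ℂ) (hp : p.Prime)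
    (a : ℕ) :
    LSeries.term (fun n ↦ (Frk r k n : ℂ)) s (p ^ (a + 1)) =
      1 / (k : ℂ) * (((⌈((a + 1 : ℕ) : ℚ) / (r : ℚ)⌉ + 1 : ℤ) : ℂ) *
        (p : ℂ) ^ (-((a + 1 : ℕ) : ℂ) * s)) := by
  rw [LSeries.term_of_ne_zero (pow_ne_zero _ hp.ne_zero), Frk_prime_pow_succ hr k hp, neg_mul,
    Complex.cpow_neg, Complex.natCast_cpow_natCast_mul,
    ← Nat.cast_pow, Complex.ofReal_div, Complex.ofReal_intCast]
  ring

theorem tsum_LSeries_term_Frk_prime_pow {r p : ℕ} {k : ℝ} (hr : r ≠ 0) (hk : 1 ≤ k) {s : ℂ}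
    (hs : 1 < s.re) (hp : p.Prime) :
    ∑' e : ℕ, LSeries.term (fun n ↦ (Frk r k n : ℂ)) s (p ^ e) =
      1 + 1 / (k : ℂ) * ∑' a : ℕ, ((⌈((a + 1 : ℕ) : ℚ) / (r : ℚ)⌉ + 1 : ℤ) : ℂ) *
        (p : ℂ) ^ (-((a + 1 : ℕ) : ℂ) * s) := by
  have hsum : Summable fun e : ℕ ↦ LSeries.term (fun n ↦ (Frk r k n : ℂ)) s (p ^ e) :=
    (LSeriesSummable_Frk hr hk hs).comp_injective (Nat.pow_right_injective hp.two_le)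
  rw [hsum.tsum_eq_zero_add, ← tsum_mul_left]
  congr 1
  · simp [LSeries.term_of_ne_zero, Frk_one hr]
  · exact tsum_congr fun a ↦ LSeries_term_Frk_prime_pow_succ hr k s hp a

theorem dirichlet_series_euler_product (r : ℕ) (hr : 2 ≤ r) (k : ℝ) (hk : 1 ≤ k)
    (s : ℂ) (hs : 1 < s.re) :
    Summable (fun n : ℕ => ‖(Frk r k (n + 1) : ℂ) / ((n + 1 : ℕ) : ℂ) ^ s‖) ∧
      ∑' n : ℕ, (Frk r k (n + 1) : ℂ) / ((n + 1 : ℕ) : ℂ) ^ s =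
        ∏' p : Nat.Primes,
          (1 + (1 / (k : ℂ)) * ∑' a : ℕ,
            ((⌈(((a + 1 : ℕ) : ℚ)) / (r : ℚ)⌉ + 1 : ℤ) : ℂ) *
              ((p : ℕ) : ℂ) ^ (-(((a + 1 : ℕ) : ℂ)) * s)) := by
  have hr0 : r ≠ 0 := by omega
  have hsum := LSeriesSummable_Frk hr0 hk hs
  have hterm (n : ℕ) : (Frk r k (n + 1) : ℂ) / ((n + 1 : ℕ) : ℂ) ^ s =
      LSeries.term (fun n ↦ (Frk r k n : ℂ)) s (n + 1) :=
    (LSeries.term_of_ne_zero n.succ_ne_zero (fun n ↦ (Frk r k n : ℂ)) s).symm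
  simp only [hterm]
  refine ⟨(summable_nat_add_iff 1).mpr hsum.norm, ?_⟩
  have hsplit := hsum.tsum_eq_zero_add
  rw [LSeries.term_zero, zero_add] at hsplit
  rw [← hsplit, ← EulerProduct.eulerProduct_tprod (by simp [LSeries.term_of_ne_zero, Frk_one hr0])
    (LSeries_term_Frk_mul hr0 k s) hsum.norm (LSeries.term_zero _ s)]
  exact tprod_congr fun p ↦ tsum_LSeries_term_Frk_prime_pow hr0 hk hs p.prop
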